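/- (Liouville theorem in the whole space.) Let N ≥ 1 and let f satisfy (H2). Then every bounded nonnegative C² solution u of Δu + f(u) = 0 in ℝ^N is constant (and its constant value is a zero of f). -/

import Mathlib

open Set Filter

noncomputable section

/-- Partial derivative of `u` in the `i`-th coordinate direction. -/
def pd {N : ℕ} (i : Fin N) (u : (Fin N → ℝ) → ℝ) (x : Fin N → ℝ) : ℝ :=
  deriv (fun t => u (Function.update x i t)) (x i)

/-- Laplace operator: the sum of the pure second partial derivatives. -/
def lap {N : ℕ} (u : (Fin N → ℝ) → ℝ) (x : Fin N → ℝ) : ℝ :=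
  ∑ i, pd i (pd i u) x

/-- `f` is locally Lipschitz-continuous on `[0, +∞)`. -/
def LocLipOn (f : ℝ → ℝ) : Prop :=
  ∀ b : ℝ, ∃ L : NNReal, LipschitzOnWith L f (Set.Icc 0 b)

/-- Hypothesis (H1): `f` is locally Lipschitz on `[0,∞)`, positive on `(0,μ)`, nonpositive on
`[μ,∞)`, nonincreasing on `[μ',μ]`, and either `f(0) > 0` or `f(0) = 0` with
`liminf_{s→0⁺} f(s)/s > 0`. -/
def H1 (f : ℝ → ℝ) (μ' μ : ℝ) : Prop :=
  LocLipOn f ∧ 0 < μ' ∧ μ' < μ ∧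
  (∀ s, 0 < s → s < μ → 0 < f s) ∧
  (∀ s, μ ≤ s → f s ≤ 0) ∧
  (∀ s t, μ' ≤ s → s ≤ t → t ≤ μ → f t ≤ f s) ∧
  (0 < f 0 ∨ (f 0 = 0 ∧ ∃ c > 0, ∀ᶠ s in nhdsWithin (0:ℝ) (Set.Ioi 0), c ≤ f s / s))

/-- Hypothesis (H2): `f` is locally Lipschitz and nonnegative on `[0,∞)`, and at every
nonnegative zero `z` of `f`, `liminf_{s→z⁺} f(s)/(s-z) > 0`. -/
def H2 (f : ℝ → ℝ) : Prop :=
  LocLipOn f ∧ (∀ s, 0 ≤ s → 0 ≤ f s) ∧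
  (∀ z, 0 ≤ z → f z = 0 → ∃ c > 0, ∀ᶠ s in nhdsWithin z (Set.Ioi z), c ≤ f s / (s - z))

/-- Hypothesis (H3): `liminf_{s→z⁻} f(s)/(s-z) > 0` for every zero `z > μ` of `f`. -/
def H3 (f : ℝ → ℝ) (μ : ℝ) : Prop :=
  ∀ z, μ < z → f z = 0 → ∃ c > 0, ∀ᶠ s in nhdsWithin z (Set.Iio z), c ≤ f s / (s - z)

/-- `(V, V')` is a `C²` solution on `[0,+∞)` of `V'' + f(V) = 0` with `V(0) = 0`,
`0 < V < z` on `(0,+∞)` and `V(+∞) = z` (the one-dimensional profile `V_z`). -/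
def IsProfile (f : ℝ → ℝ) (z : ℝ) (V V' : ℝ → ℝ) : Prop :=
  (∀ ξ ∈ Set.Ici (0:ℝ), HasDerivWithinAt V (V' ξ) (Set.Ici 0) ξ) ∧
  (∀ ξ ∈ Set.Ici (0:ℝ), HasDerivWithinAt V' (-(f (V ξ))) (Set.Ici 0) ξ) ∧
  V 0 = 0 ∧ (∀ ξ, 0 < ξ → 0 < V ξ ∧ V ξ < z) ∧
  Filter.Tendsto V Filter.atTop (nhds z)

/-- The translates `x ↦ u(x + h e₁)` converge as `h → +∞`, uniformly on `K` together with all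
partial derivatives up to order two, to the limits `w`, `w1 i`, `w2 i j`. -/
def C2ConvOn {N : ℕ} (i0 : Fin N) (u : (Fin N → ℝ) → ℝ) (K : Set (Fin N → ℝ))
    (w : (Fin N → ℝ) → ℝ) (w1 : Fin N → (Fin N → ℝ) → ℝ)
    (w2 : Fin N → Fin N → (Fin N → ℝ) → ℝ) : Prop :=
  TendstoUniformlyOn (fun (h : ℝ) x => u (Function.update x i0 (x i0 + h))) w
    Filter.atTop K ∧
  (∀ i, TendstoUniformlyOn (fun (h : ℝ) x => pd i u (Function.update x i0 (x i0 + h)))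
      (w1 i) Filter.atTop K) ∧
  (∀ i j, TendstoUniformlyOn
      (fun (h : ℝ) x => pd i (pd j u) (Function.update x i0 (x i0 + h)))
      (w2 i j) Filter.atTop K)

/-- `F(z) = ∫₀^z f(σ) dσ`. -/
def Ff (f : ℝ → ℝ) (z : ℝ) : ℝ := ∫ σ in (0:ℝ)..z, f σ

/-- The set `Z_f = {z₀ ≥ 0 : f(z₀) = 0 and F(z) < F(z₀) for all z ∈ [0,z₀)}`. -/
def Zf (f : ℝ → ℝ) : Set ℝ :=
  {z | 0 ≤ z ∧ f z = 0 ∧ ∀ w, 0 ≤ w → w < z → Ff f w < Ff f z}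

/-- `(V, V')` belongs to `R_f`: a bounded nonnegative `C²` solution on `[0,∞)` of
`V'' + f(V) = 0` with `V(0) = 0`. -/
def InRf (f V V' : ℝ → ℝ) : Prop :=
  (∀ ξ ∈ Set.Ici (0:ℝ), HasDerivWithinAt V (V' ξ) (Set.Ici 0) ξ) ∧
  (∀ ξ ∈ Set.Ici (0:ℝ), HasDerivWithinAt V' (-(f (V ξ))) (Set.Ici 0) ξ) ∧
  V 0 = 0 ∧ (∀ ξ, 0 ≤ ξ → 0 ≤ V ξ) ∧ (∃ C, ∀ ξ, 0 ≤ ξ → V ξ ≤ C)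

/-- The squared Euclidean distance on `Fin N → ℝ`. -/
def sqDist {N : ℕ} (p x : Fin N → ℝ) : ℝ := ∑ i, (x i - p i) ^ 2

lemma continuous_sqDist {N : ℕ} (p : Fin N → ℝ) : Continuous (sqDist p) := by
  unfold sqDist
  fun_prop

lemma sqDist_nonneg {N : ℕ} (p x : Fin N → ℝ) : 0 ≤ sqDist p x :=
  Finset.sum_nonneg fun _ _ => sq_nonneg _

lemma sqDist_self {N : ℕ} (p : Fin N → ℝ) : sqDist p p = 0 := by
  simp [sqDist]

lemma sq_sub_le_sqDist {N : ℕ} (p x : Fin N → ℝ) (i : Fin N) :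
    (x i - p i) ^ 2 ≤ sqDist p x :=
  Finset.single_le_sum (f := fun i => (x i - p i) ^ 2) (fun _ _ => sq_nonneg _)
    (Finset.mem_univ i)

lemma sqDist_update {N : ℕ} (p x : Fin N → ℝ) (i : Fin N) (s : ℝ) :
    sqDist p (Function.update x i s) = (s - p i) ^ 2 + (sqDist p x - (x i - p i) ^ 2) := by
  unfold sqDist
  rw [← Finset.add_sum_erase _ _ (Finset.mem_univ i),
    ← Finset.add_sum_erase (a := i) _ (fun j => (x j - p j) ^ 2) (Finset.mem_univ i)]
  have h : ∑ j ∈ Finset.univ.erase i, (Function.update x i s j - p j) ^ 2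
      = ∑ j ∈ Finset.univ.erase i, (x j - p j) ^ 2 :=
    Finset.sum_congr rfl fun j hj => by
      rw [Function.update_of_ne (Finset.ne_of_mem_erase hj)]
  rw [h, Function.update_self]
  ring

lemma isCompact_sqDist_le {N : ℕ} (p : Fin N → ℝ) (ρ : ℝ) :
    IsCompact {x | sqDist p x ≤ ρ} := by
  refine (isCompact_closedBall p (√ρ)).of_isClosed_subset
    (isClosed_le (continuous_sqDist p) continuous_const) fun x hx => ?_
  rw [Metric.mem_closedBall, dist_pi_le_iff (Real.sqrt_nonneg _)]
  intro i
  rw [Real.dist_eq]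
  exact Real.abs_le_sqrt ((sq_sub_le_sqDist p x i).trans hx)

lemma exists_lt_of_sqDist_lt {N : ℕ} {u : (Fin N → ℝ) → ℝ} (hu : Continuous u)
    {p : Fin N → ℝ} {a : ℝ} (hp : a < u p) :
    ∃ ρ > 0, ∀ x, sqDist p x < ρ → a < u x := by
  obtain ⟨ε, hε, h⟩ := Metric.isOpen_iff.1 (isOpen_lt continuous_const hu) p hp
  refine ⟨ε ^ 2, by positivity, fun x hx => h ?_⟩
  rw [Metric.mem_ball, dist_pi_lt_iff hε]
  intro i
  rw [Real.dist_eq]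
  exact abs_lt_of_sq_lt_sq ((sq_sub_le_sqDist p x i).trans_lt hx) hε.le

lemma IsLocalMin.deriv_deriv_nonneg {φ : ℝ → ℝ} {a : ℝ} (h : IsLocalMin φ a)
    (hc : ContinuousAt φ a) : 0 ≤ deriv (deriv φ) a := by
  by_contra! hneg
  have hmax := isLocalMax_of_deriv_deriv_neg hneg h.deriv_eq_zero hc
  have heq : φ =ᶠ[nhds a] fun _ => φ a := by
    filter_upwards [h, hmax] with x h₁ h₂ using le_antisymm h₂ h₁
  have := heq.deriv.deriv_eq
  simp at this
  linarith

lemma pd_pd_eq {N : ℕ} (i : Fin N) (u : (Fin N → ℝ) → ℝ) (x : Fin N → ℝ) :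
    pd i (pd i u) x = deriv (deriv fun s => u (Function.update x i s)) (x i) := by
  simp [pd, Function.update_idem]

/-- Second-order condition at a point where `u` touches a radial function from above. -/
lemma le_lap_of_isLocalMin {N : ℕ} {u : (Fin N → ℝ) → ℝ} (hu : ContDiff ℝ 2 u)
    {g g' g'' : ℝ → ℝ} (hg : ∀ t, HasDerivAt g (g' t) t) (hg' : ∀ t, HasDerivAt g' (g'' t) t)
    {p x : Fin N → ℝ} (hmin : IsLocalMin (fun y => u y - g (sqDist p y)) x) :
    4 * sqDist p x * g'' (sqDist p x) + 2 * N * g' (sqDist p x) ≤ lap u x := by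
  have key : ∀ i, g'' (sqDist p x) * (4 * (x i - p i) ^ 2) + 2 * g' (sqDist p x)
      ≤ pd i (pd i u) x := by
    intro i
    rw [pd_pd_eq]
    set U : ℝ → ℝ := fun s => u (Function.update x i s) with hU
    have hUc : ContDiff ℝ 2 U := hu.comp (contDiff_update 2 x i)
    set q : ℝ → ℝ := fun s => (s - p i) ^ 2 + (sqDist p x - (x i - p i) ^ 2) with hq
    have hqx : q (x i) = sqDist p x := by simp [hq]
    have hq' : ∀ s, HasDerivAt q (2 * (s - p i)) s := fun s => by
      simpa [hq] using (((hasDerivAt_id s).sub_const (p i)).pow 2).add_const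
        (sqDist p x - (x i - p i) ^ 2)
    have hG : ∀ s, HasDerivAt (fun s => g (q s)) (g' (q s) * (2 * (s - p i))) s :=
      fun s => (hg (q s)).comp s (hq' s)
    have hG' : HasDerivAt (fun s => g' (q s) * (2 * (s - p i)))
        (g'' (q (x i)) * (2 * (x i - p i)) * (2 * (x i - p i)) + g' (q (x i)) * (2 * 1)) (x i) :=
      ((hg' (q (x i))).comp (x i) (hq' (x i))).mul
        (((hasDerivAt_id (x i)).sub_const (p i)).const_mul 2)
    have hUd : Differentiable ℝ U := hUc.differentiable (by norm_num)
    have hUd' : Differentiable ℝ (deriv U) :=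
      ((contDiff_succ_iff_deriv (n := 1)).1 hUc).2.2.differentiable (by norm_num)
    have hloc : IsLocalMin (fun s => U s - g (q s)) (x i) := by
      have hcont : Tendsto (fun s => Function.update x i s) (nhds (x i)) (nhds x) := by
        have : Continuous fun s : ℝ => Function.update x i s := by fun_prop
        simpa using this.tendsto (x i)
      filter_upwards [hcont.eventually hmin] with s hs
      simpa [hU, hqx, sqDist_update, hq] using hs
    have hd : deriv (fun s => U s - g (q s))
        = fun s => deriv U s - g' (q s) * (2 * (s - p i)) :=
      funext fun s => ((hUd s).hasDerivAt.sub (hG s)).deriv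
    have h := hloc.deriv_deriv_nonneg (((hUd _).hasDerivAt.sub (hG _)).continuousAt)
    rw [hd, HasDerivAt.deriv (f := fun s => deriv U s - g' (q s) * (2 * (s - p i))) ((hUd' _).hasDerivAt.sub hG'), hqx] at h
    linarith
  calc _ = ∑ i, (g'' (sqDist p x) * (4 * (x i - p i) ^ 2) + 2 * g' (sqDist p x)) := by
        rw [Finset.sum_add_distrib, ← Finset.mul_sum, ← Finset.mul_sum]
        simp only [sqDist, Finset.sum_const, Finset.card_univ, Fintype.card_fin, nsmul_eq_mul]
        ring
    _ ≤ _ := Finset.sum_le_sum fun i _ => key i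

lemma isLocalMin_of_sqDist_lt {N : ℕ} {φ : (Fin N → ℝ) → ℝ} {p x : Fin N → ℝ} {ρ : ℝ}
    (hx : sqDist p x < ρ) (h : ∀ y, sqDist p y ≤ ρ → φ x ≤ φ y) : IsLocalMin φ x := by
  filter_upwards [(isOpen_lt (continuous_sqDist p) continuous_const).mem_nhds hx] with y hy
  exact h y (le_of_lt hy)

/-- If a radial function lies below `u` on a sphere but not inside it, then a second-order
condition holds at some interior point where it exceeds `u`. -/
lemma exists_le_lap_of_lt {N : ℕ} {u : (Fin N → ℝ) → ℝ} (hu : ContDiff ℝ 2 u)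
    {g g' g'' : ℝ → ℝ} (hg : ∀ t, HasDerivAt g (g' t) t) (hg' : ∀ t, HasDerivAt g' (g'' t) t)
    {p y : Fin N → ℝ} {ρ : ℝ} (hbd : ∀ x, sqDist p x = ρ → g ρ ≤ u x)
    (hy : sqDist p y ≤ ρ) (hlt : u y < g (sqDist p y)) :
    ∃ x, u x < g (sqDist p x) ∧
      4 * sqDist p x * g'' (sqDist p x) + 2 * N * g' (sqDist p x) ≤ lap u x := by
  have hgc : Continuous g := continuous_iff_continuousAt.2 fun t => (hg t).continuousAt
  obtain ⟨x, hxρ, hx⟩ := (isCompact_sqDist_le p ρ).exists_isMinOn ⟨y, hy⟩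
    (f := fun z => u z - g (sqDist p z))
    (hu.continuous.sub (hgc.comp (continuous_sqDist p))).continuousOn
  have hneg : u x < g (sqDist p x) := by
    have : u x - g (sqDist p x) ≤ u y - g (sqDist p y) := hx hy
    linarith
  have hlt' : sqDist p x < ρ := by
    refine lt_of_le_of_ne hxρ fun h => ?_
    have := hbd x h
    rw [h] at hneg
    linarith
  exact ⟨x, hneg, le_lap_of_isLocalMin hu hg hg'
    (isLocalMin_of_sqDist_lt hlt' fun z hz => hx hz)⟩

/-- The infimum of a nonnegative solution is a zero of `f`. -/
lemma eq_zero_of_isGLB {N : ℕ} (hN : 1 ≤ N) {f : ℝ → ℝ} (hf : LocLipOn f)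
    (hf0 : ∀ s, 0 ≤ s → 0 ≤ f s) {u : (Fin N → ℝ) → ℝ} (hu : ContDiff ℝ 2 u)
    (hpde : ∀ x, lap u x + f (u x) = 0) {m : ℝ} (hm0 : 0 ≤ m) (hm : IsGLB (range u) m) :
    f m = 0 := by
  have hle : ∀ x, m ≤ u x := fun x => hm.1 (mem_range_self x)
  obtain ⟨L, hL⟩ := hf (m + 1)
  have hN' : (0 : ℝ) < N := by exact_mod_cast hN
  have key : ∀ η : ℝ, 0 < η → η ≤ 1 → f m ≤ (L + 1) * η := by
    intro η hη hη1
    obtain ⟨_, ⟨p, rfl⟩, hp⟩ := (isGLB_lt_iff hm).1 (lt_add_of_pos_right m hη)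
    have hg : ∀ t, HasDerivAt (fun t : ℝ => m + η - η * t / (2 * N)) (-(η * 1 / (2 * N))) t :=
      fun t => (((hasDerivAt_id t).const_mul η).div_const _).const_sub _
    obtain ⟨x, hx, hlap⟩ := exists_le_lap_of_lt hu (p := p) (y := p) (ρ := 2 * N) hg
      (g'' := fun _ => 0) (fun t => hasDerivAt_const _ _)
      (fun x _ => by
        have := hle x
        field_simp
        linarith)
      (by rw [sqDist_self]; positivity) (by simpa [sqDist_self] using hp)
    have hxη : u x < m + η := by
      have : 0 ≤ η * sqDist p x / (2 * N) :=
        div_nonneg (mul_nonneg hη.le (sqDist_nonneg p x)) (by positivity)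
      linarith
    have h₁ := hL.dist_le_mul (u x) ⟨hm0.trans (hle x), by linarith⟩ m ⟨hm0, by linarith⟩
    rw [Real.dist_eq, Real.dist_eq, abs_of_nonneg (sub_nonneg.2 (hle x))] at h₁
    have h₂ : (L : ℝ) * (u x - m) ≤ L * η :=
      mul_le_mul_of_nonneg_left (by linarith) L.coe_nonneg
    have h₃ : 2 * (N : ℝ) * -(η * 1 / (2 * N)) = -η := by field_simp
    have h₄ := (abs_le.1 h₁).1
    have h₅ := hpde x
    simp only [mul_zero, zero_add, h₃] at hlap
    linarith
  refine le_antisymm ?_ (hf0 m hm0)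
  by_contra! hpos
  have hL1 : (0 : ℝ) < L + 1 := by positivity
  have h := key (min 1 (f m / (2 * (L + 1)))) (by positivity) (min_le_left _ _)
  have h' : ((L : ℝ) + 1) * min 1 (f m / (2 * (L + 1))) ≤ (L + 1) * (f m / (2 * (L + 1))) :=
    mul_le_mul_of_nonneg_left (min_le_right _ _) hL1.le
  have h'' : ((L : ℝ) + 1) * (f m / (2 * (L + 1))) = f m / 2 := by field_simp
  linarith

/-- Strong minimum principle on the whole space. -/
lemma lt_of_lap_nonpos {N : ℕ} (hN : 1 ≤ N) {u : (Fin N → ℝ) → ℝ} (hu : ContDiff ℝ 2 u)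
    (hlap : ∀ x, lap u x ≤ 0) {m : ℝ} (hm : ∀ x, m ≤ u x) {p : Fin N → ℝ} (hp : m < u p)
    (y : Fin N → ℝ) : m < u y := by
  have hN' : (1 : ℝ) ≤ N := by exact_mod_cast hN
  obtain ⟨b, hb, hbp⟩ := exists_between hp
  obtain ⟨ρ, hρ, hball⟩ := exists_lt_of_sqDist_lt hu.continuous hbp
  set α : ℝ := N / ρ with hα
  have hα0 : 0 < α := by positivity
  set S : ℝ := sqDist p y + 1 with hS
  set E : ℝ → ℝ := fun t => Real.exp (-α * t) with hE
  have hEd : ∀ t, HasDerivAt E (-α * E t) t := fun t => by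
    have := ((hasDerivAt_id t).const_mul (-α)).exp
    simpa [hE, mul_comm] using this
  by_contra! hy
  have hES : E S < E (sqDist p y) := by
    apply Real.exp_lt_exp.2
    rw [hS]
    linarith
  obtain ⟨x, hx, hxlap⟩ := exists_le_lap_of_lt hu (p := p) (y := y) (ρ := S)
    (g := fun t => m + (b - m) * (E t - E S)) (g' := fun t => (b - m) * (-α * E t))
    (g'' := fun t => (b - m) * (-α * (-α * E t)))
    (fun t => (((hEd t).sub_const _).const_mul _).const_add _)
    (fun t => ((hEd t).const_mul _).const_mul _)
    (fun x _ => by simpa using hm x) (by linarith)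
    (by
      have := mul_pos (sub_pos.2 hb) (sub_pos.2 hES)
      linarith)
  have hE1 : E (sqDist p x) ≤ 1 :=
    Real.exp_le_one_iff.2 (by nlinarith [sqDist_nonneg p x])
  have hES0 : 0 < E S := Real.exp_pos _
  have hEx : 0 < E (sqDist p x) := Real.exp_pos _
  have hxρ : ρ ≤ sqDist p x := by
    by_contra! h
    have := hball x h
    nlinarith
  have hαt : (N : ℝ) ≤ α * sqDist p x := by
    calc (N : ℝ) = α * ρ := by rw [hα]; field_simp
      _ ≤ _ := mul_le_mul_of_nonneg_left hxρ hα0.le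
  have hfac : 4 * sqDist p x * ((b - m) * (-α * (-α * E (sqDist p x))))
      + 2 * N * ((b - m) * (-α * E (sqDist p x)))
      = ((b - m) * α * E (sqDist p x)) * (4 * (α * sqDist p x) - 2 * N) := by ring
  have hpos : 0 < ((b - m) * α * E (sqDist p x)) * (4 * (α * sqDist p x) - 2 * N) :=
    mul_pos (mul_pos (mul_pos (sub_pos.2 hb) hα0) hEx) (by linarith)
  simp only [hfac] at hxlap
  linarith [hlap x]

/-- A solution lying strictly above `m` is bounded away from `m` when `f` grows at least linearly
to the right of `m`. -/
lemma add_le_of_linear_growth {N : ℕ} {f : ℝ → ℝ} {u : (Fin N → ℝ) → ℝ} (hu : ContDiff ℝ 2 u)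
    (hpde : ∀ x, lap u x + f (u x) = 0) {m c δ : ℝ} (hc : 0 < c) (hδ : 0 < δ)
    (hf : ∀ s, m < s → s ≤ m + δ → c * (s - m) ≤ f s) (hm : ∀ x, m < u x)
    (y : Fin N → ℝ) : m + δ ≤ u y := by
  by_contra! hy
  set ρ : ℝ := ((N : ℝ) + 2) ^ 2 / c with hρ
  have hρ0 : 0 < ρ := by positivity
  have hcont : Continuous fun z : ℝ × (Fin N → ℝ) =>
      m + z.1 * (1 - sqDist y z.2 / ρ) ^ 2 := by
    have := continuous_sqDist y
    fun_prop
  set K : Set (ℝ × (Fin N → ℝ)) := (Icc 0 δ ×ˢ {x | sqDist y x ≤ ρ}) ∩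
    {z | u z.2 ≤ m + z.1 * (1 - sqDist y z.2 / ρ) ^ 2} with hK
  have hKc : IsCompact K := (isCompact_Icc.prod (isCompact_sqDist_le y ρ)).inter_right
    (isClosed_le (hu.continuous.comp continuous_snd) hcont)
  have hKne : (δ, y) ∈ K :=
    ⟨⟨⟨hδ.le, le_rfl⟩, by simpa [sqDist_self] using hρ0.le⟩, by simpa [sqDist_self] using hy.le⟩
  obtain ⟨⟨τ, x⟩, ⟨⟨⟨hτ0, hτδ⟩, hxρ⟩, hxu⟩, hmin⟩ :=
    hKc.exists_isMinOn ⟨_, hKne⟩ continuous_fst.continuousOn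
  simp only [mem_ofPred_eq] at hτ0 hτδ hxρ hxu
  have hbelow : ∀ σ, 0 ≤ σ → σ < τ → ∀ z, sqDist y z ≤ ρ →
      m + σ * (1 - sqDist y z / ρ) ^ 2 < u z := by
    intro σ hσ hστ z hz
    by_contra! h
    have : τ ≤ σ := hmin (show (σ, z) ∈ K from ⟨⟨⟨hσ, hστ.le.trans hτδ⟩, hz⟩, h⟩)
    linarith
  have hφ : 0 < τ * (1 - sqDist y x / ρ) ^ 2 := by linarith [hm x]
  have hτ : 0 < τ := pos_of_mul_pos_left hφ (sq_nonneg _)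
  have habove : ∀ z, sqDist y z ≤ ρ → m + τ * (1 - sqDist y z / ρ) ^ 2 ≤ u z := by
    intro z hz
    refine le_of_tendsto (f := fun σ : ℝ => m + σ * (1 - sqDist y z / ρ) ^ 2)
      (x := nhdsWithin τ (Iio τ)) ?_ ?_
    · exact (Continuous.tendsto (by fun_prop) τ).mono_left nhdsWithin_le_nhds
    · filter_upwards [Ioo_mem_nhdsLT hτ] with σ hσ
      exact (hbelow σ hσ.1.le hσ.2 z hz).le
  have hxeq : u x = m + τ * (1 - sqDist y x / ρ) ^ 2 := le_antisymm hxu (habove x hxρ)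
  have hxlt : sqDist y x < ρ := by
    refine lt_of_le_of_ne hxρ fun h => ?_
    rw [h, div_self hρ0.ne'] at hφ
    simp at hφ
  have hd : ∀ t : ℝ, HasDerivAt (fun t : ℝ => 1 - t / ρ) (-(1 / ρ)) t := fun t =>
    ((hasDerivAt_id t).div_const ρ).const_sub 1
  have hlap := le_lap_of_isLocalMin hu (p := y) (x := x)
    (g := fun t => m + τ * (1 - t / ρ) ^ 2)
    (g' := fun t => τ * (2 * (1 - t / ρ) * -(1 / ρ)))
    (g'' := fun _ => τ * (2 * -(1 / ρ) * -(1 / ρ)))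
    (fun t => by simpa using (((hd t).pow 2).const_mul τ).const_add m)
    (fun t => (((hd t).const_mul 2).mul_const (-(1 / ρ))).const_mul τ)
    (isLocalMin_of_sqDist_lt hxlt fun z hz => by
      have := habove z hz
      linarith)
  set a : ℝ := 1 - sqDist y x / ρ with ha
  have ha1 : a ^ 2 ≤ 1 := by
    have h₁ : sqDist y x / ρ ≤ 1 := (div_le_one hρ0).2 hxρ
    have h₂ : 0 ≤ sqDist y x / ρ := div_nonneg (sqDist_nonneg _ _) hρ0.le
    nlinarith
  have hfx := hf (u x) (hm x) (by rw [hxeq]; nlinarith)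
  have hux : u x - m = τ * a ^ 2 := by rw [hxeq]; ring
  rw [hux] at hfx
  have ht : sqDist y x = (1 - a) * ρ := by rw [ha]; field_simp; ring
  have hcρ : c = ((N : ℝ) + 2) ^ 2 / ρ := by rw [hρ]; field_simp
  have hsum : 4 * sqDist y x * (τ * (2 * -(1 / ρ) * -(1 / ρ)))
      + 2 * N * (τ * (2 * a * -(1 / ρ))) + c * (τ * a ^ 2)
      = τ / ρ * ((((N : ℝ) + 2) * a - 2) ^ 2 + 4) := by
    rw [ht, hcρ]
    field_simp
    ring
  have hpos : 0 < τ / ρ * ((((N : ℝ) + 2) * a - 2) ^ 2 + 4) := by positivity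
  have := hpde x
  linarith

/-- Theorem 2.5 (Liouville theorem in the whole space): under (H2), every bounded nonnegative
`C²` solution of `Δu + f(u) = 0` in `ℝ^N` is constant, with value a zero of `f`. -/
theorem stmt_5
    {N : ℕ} (hN : 1 ≤ N) (f : ℝ → ℝ) (hf : H2 f)
    (u : (Fin N → ℝ) → ℝ)
    (hu_smooth : ContDiff ℝ 2 u)
    (hu_nonneg : ∀ x, 0 ≤ u x)
    (hu_bdd : ∃ C, ∀ x, u x ≤ C)
    (hu_pde : ∀ x, lap u x + f (u x) = 0) :
    ∃ c : ℝ, (∀ x, u x = c) ∧ f c = 0 := by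
  obtain ⟨hLip, hf0, hfz⟩ := hf
  have hbdd : BddBelow (range u) := ⟨0, by rintro _ ⟨x, rfl⟩; exact hu_nonneg x⟩
  have hm := isGLB_csInf (range_nonempty u) hbdd
  set m := sInf (range u)
  have hle : ∀ x, m ≤ u x := fun x => hm.1 (mem_range_self x)
  have hm0 : 0 ≤ m := hm.2 (by rintro _ ⟨x, rfl⟩; exact hu_nonneg x)
  have hfm := eq_zero_of_isGLB hN hLip hf0 hu_smooth hu_pde hm0 hm
  refine ⟨m, fun x => ?_, hfm⟩
  by_contra hne
  have hlt := lt_of_lap_nonpos hN hu_smooth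
    (fun x => by linarith [hu_pde x, hf0 _ (hu_nonneg x)]) hle (lt_of_le_of_ne' (hle x) hne)
  obtain ⟨c, hc, hev⟩ := hfz m hm0 hfm
  obtain ⟨b, hb, hsub⟩ := (mem_nhdsGT_iff_exists_Ioc_subset).1 hev
  have hb' : m < b := hb
  have hlow := add_le_of_linear_growth hu_smooth hu_pde hc (sub_pos.2 hb')
    (fun s hs hsb => (le_div_iff₀ (sub_pos.2 hs)).1 (hsub ⟨hs, by linarith⟩)) hlt
  have : m + (b - m) ≤ m := hm.2 (by rintro _ ⟨z, rfl⟩; exact hlow z)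
  linarith
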